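/- arXiv:2406.12457 — 2 statements merged into one kernel-verified Lean document; each statement's English description precedes it below -/
import Mathlib

section
/- Fix reals L, H with δ := H − L > 0, reals 0 < v_L < v_H with Δv := v_H − v_L, μ0 ∈ (0,1) with μ0 < v_L/v_H, and a real V. Then the maximum of Ψ over the small-prior feasible set F⁻ equals V, and a mechanism m ∈ F⁻ is a maximizer if and only if x_H = H, x_L = L, f_L = V, f_H = V + (πH − 1)·Δv, πL = 1, and max(1 − δ²/Δv, 0) ≤ πH ≤ 1. -/
/-- A mechanism: service provisions `xH, xL`, fees `fH, fL`,
and disclosure probabilities `piL, piH` of the low-price signal. -/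
structure Mech where
  xH : ℝ
  xL : ℝ
  fH : ℝ
  fL : ℝ
  piL : ℝ
  piH : ℝ

/-- Large-prior feasible set F⁺. -/
def FeasPlus (L H vL vH μ0 V : ℝ) (m : Mech) : Prop :=
  0 ≤ m.piL ∧ m.piL ≤ 1 ∧ 0 ≤ m.piH ∧ m.piH ≤ 1 ∧
  (-(m.xH - H)^2 - m.fH + m.piH * (vH - vL) ≥ -(m.xL - H)^2 - m.fL + m.piL * (vH - vL)) ∧
  (-(m.xL - L)^2 - m.fL ≥ -(m.xH - L)^2 - m.fH) ∧
  (V - (m.xH - H)^2 - m.fH + m.piH * (vH - vL) ≥ 0) ∧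
  (V - (m.xL - L)^2 - m.fL ≥ 0) ∧
  ((1 - vL / vH) * μ0 * m.piH ≤ (vL / vH) * (1 - μ0) * m.piL)

/-- Large-prior objective Φ. -/
noncomputable def Phi (vL vH μ0 : ℝ) (m : Mech) : ℝ :=
  μ0 * m.fH + (1 - μ0) * m.fL - μ0 * m.piH * (vH - vL) + (1 - μ0) * m.piL * vL

/-- Small-prior feasible set F⁻. -/
def FeasMinus (L H vL vH μ0 V : ℝ) (m : Mech) : Prop :=
  0 ≤ m.piL ∧ m.piL ≤ 1 ∧ 0 ≤ m.piH ∧ m.piH ≤ 1 ∧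
  (-(m.xH - H)^2 - m.fH + m.piH * (vH - vL) ≥ -(m.xL - H)^2 - m.fL + m.piL * (vH - vL)) ∧
  (-(m.xL - L)^2 - m.fL ≥ -(m.xH - L)^2 - m.fH) ∧
  (V - (m.xH - H)^2 - m.fH + m.piH * (vH - vL) ≥ vH - vL) ∧
  (V - (m.xL - L)^2 - m.fL ≥ 0) ∧
  ((vL / vH) * (1 - μ0) * m.piL - (1 - vL / vH) * μ0 * m.piH ≥ vL / vH - μ0)

/-- Small-prior objective Ψ. -/
noncomputable def Psi (vL vH μ0 : ℝ) (m : Mech) : ℝ :=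
  μ0 * m.fH + (1 - μ0) * m.fL + (1 - μ0) * m.piL * vL - μ0 * m.piH * (vH - vL) + μ0 * vH - vL

/-- `m` maximizes `f` over `F`. -/
def IsMaximizer {α : Type*} (F : Set α) (f : α → ℝ) (m : α) : Prop :=
  m ∈ F ∧ ∀ m' ∈ F, f m' ≤ f m

/-- The gap `V - Ψ` as a weighted sum of the slacks of the participation constraints,
the squared distortions, and the shortfall of `piL` from `1`. -/
lemma sub_Psi_eq (L H vL vH μ0 V : ℝ) (m : Mech) :
    V - Psi vL vH μ0 m =
      μ0 * (V - (m.xH - H)^2 - m.fH + m.piH * (vH - vL) - (vH - vL)) + μ0 * (m.xH - H)^2 +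
      (1 - μ0) * (V - (m.xL - L)^2 - m.fL) + (1 - μ0) * (m.xL - L)^2 +
      (1 - μ0) * vL * (1 - m.piL) := by
  unfold Psi
  ring

lemma Psi_le_of_feasMinus {L H vL vH μ0 V : ℝ} (hvL : 0 ≤ vL)
    (hμ : μ0 ∈ Set.Icc (0:ℝ) 1) {m : Mech} (hm : FeasMinus L H vL vH μ0 V m) :
    Psi vL vH μ0 m ≤ V := by
  obtain ⟨_, hpL, _, _, _, _, hH, hL, _⟩ := hm
  have hμ' : 0 ≤ 1 - μ0 := sub_nonneg.2 hμ.2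
  have h1 := mul_nonneg hμ.1 (sub_nonneg.2 hH)
  have h2 := mul_nonneg hμ.1 (sq_nonneg (m.xH - H))
  have h3 := mul_nonneg hμ' hL
  have h4 := mul_nonneg hμ' (sq_nonneg (m.xL - L))
  have h5 := mul_nonneg (mul_nonneg hμ' hvL) (sub_nonneg.2 hpL)
  linarith [sub_Psi_eq L H vL vH μ0 V m]

/-- A feasible mechanism attaining `V` has no slack, no distortion, and `piL = 1`. -/
lemma eq_of_Psi_eq {L H vL vH μ0 V : ℝ} (hvL : 0 < vL)
    (hμ : μ0 ∈ Set.Ioo (0:ℝ) 1) {m : Mech} (hm : FeasMinus L H vL vH μ0 V m)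
    (h : Psi vL vH μ0 m = V) :
    m.xH = H ∧ m.xL = L ∧ m.fL = V ∧ m.fH = V + (m.piH - 1) * (vH - vL) ∧ m.piL = 1 := by
  obtain ⟨_, hpL, _, _, _, _, hH, hL, _⟩ := hm
  have hμ' : 0 < 1 - μ0 := sub_pos.2 hμ.2
  have h1 := mul_nonneg hμ.1.le (sub_nonneg.2 hH)
  have h2 := mul_nonneg hμ.1.le (sq_nonneg (m.xH - H))
  have h3 := mul_nonneg hμ'.le hL
  have h4 := mul_nonneg hμ'.le (sq_nonneg (m.xL - L))
  have h5 := mul_nonneg (mul_pos hμ' hvL).le (sub_nonneg.2 hpL)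
  have key := sub_Psi_eq L H vL vH μ0 V m
  have e1 := (mul_eq_zero_iff_left hμ.1.ne').1 (le_antisymm (by linarith) h1)
  have e2 := (mul_eq_zero_iff_left hμ.1.ne').1 (le_antisymm (by linarith) h2)
  have e3 := (mul_eq_zero_iff_left hμ'.ne').1 (le_antisymm (by linarith) h3)
  have e4 := (mul_eq_zero_iff_left hμ'.ne').1 (le_antisymm (by linarith) h4)
  have e5 := (mul_eq_zero_iff_left (mul_pos hμ' hvL).ne').1 (le_antisymm (by linarith) h5)
  refine ⟨sub_eq_zero.1 (pow_eq_zero_iff two_ne_zero |>.1 e2),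
    sub_eq_zero.1 (pow_eq_zero_iff two_ne_zero |>.1 e4), ?_, ?_, ?_⟩ <;> linarith

lemma feasMinus_efficient (L H vL vH μ0 V : ℝ) :
    FeasMinus L H vL vH μ0 V ⟨H, L, V, V, 1, 1⟩ := by
  have hsq := sq_nonneg (H - L)
  refine ⟨by norm_num, by norm_num, by norm_num, by norm_num, ?_, ?_, ?_, ?_, ?_⟩ <;>
    dsimp only <;> nlinarith

theorem stmt5 (L H vL vH μ0 V : ℝ) (hLH : L < H) (hvL : 0 < vL) (hv : vL < vH)
    (hμ : μ0 ∈ Set.Ioo (0:ℝ) 1) (hprior : μ0 < vL / vH) :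
    IsGreatest (Psi vL vH μ0 '' {m | FeasMinus L H vL vH μ0 V m}) V ∧
    ∀ m : Mech, FeasMinus L H vL vH μ0 V m →
      (IsMaximizer {m' | FeasMinus L H vL vH μ0 V m'} (Psi vL vH μ0) m ↔
        (m.xH = H ∧ m.xL = L ∧ m.fL = V ∧ m.fH = V + (m.piH - 1) * (vH - vL) ∧
          m.piL = 1 ∧ max (1 - (H - L)^2 / (vH - vL)) 0 ≤ m.piH ∧ m.piH ≤ 1)) := by
  have hle {m : Mech} (hm : FeasMinus L H vL vH μ0 V m) : Psi vL vH μ0 m ≤ V :=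
    Psi_le_of_feasMinus hvL.le (Set.Ioo_subset_Icc_self hμ) hm
  have heff := feasMinus_efficient L H vL vH μ0 V
  have heffV : Psi vL vH μ0 ⟨H, L, V, V, 1, 1⟩ = V := by
    unfold Psi
    ring
  refine ⟨⟨⟨_, heff, heffV⟩, ?_⟩, fun m hm => ⟨fun hmax => ?_, ?_⟩⟩
  · rintro _ ⟨m, hm, rfl⟩
    exact hle hm
  · have hV : Psi vL vH μ0 m = V := le_antisymm (hle hm) (heffV ▸ hmax.2 _ heff)
    obtain ⟨hxH, hxL, hfL, hfH, hpL⟩ := eq_of_Psi_eq hvL hμ hm hV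
    obtain ⟨_, _, hp0, hp1, _, hIC, _⟩ := hm
    refine ⟨hxH, hxL, hfL, hfH, hpL, max_le ?_ hp0, hp1⟩
    rw [hxH, hxL, hfL, hfH] at hIC
    rw [sub_le_comm, le_div_iff₀ (sub_pos.2 hv)]
    linarith
  · rintro ⟨-, -, hfL, hfH, hpL, -, -⟩
    refine ⟨hm, fun m' hm' => (hle hm').trans_eq ?_⟩
    rw [Psi, hfL, hfH, hpL]
    ring
end

section
/- Fix reals L, H with δ := H − L > 0, reals 0 < v_L < v_H with Δv := v_H − v_L, μ0 ∈ (0,1) with μ0 > v_L/v_H, a real V, and C := ((1−μ0)·v_L)/(μ0·Δv). Assume δ² ≥ Δv. Then the maximum of Φ over the large-prior feasible set F⁺ equals V + (1−μ0)·v_L, and a mechanism m ∈ F⁺ is a maximizer if and only if x_H = H, x_L = L, f_L = V, f_H = V + πH·Δv, πL = 1, and 0 ≤ πH ≤ C. -/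
/-- The gap between the value `V + (1 - μ0) * vL` and the objective is a weighted sum of the
participation slacks, the provision distortions and the shortfall `1 - piL`. -/
theorem Phi_gap (L H vL vH μ0 V : ℝ) (m : Mech) :
    V + (1 - μ0) * vL - Phi vL vH μ0 m =
      μ0 * ((V - (m.xH - H)^2 - m.fH + m.piH * (vH - vL)) + (m.xH - H)^2) +
      (1 - μ0) * ((V - (m.xL - L)^2 - m.fL) + (m.xL - L)^2) +
      (1 - μ0) * (vL * (1 - m.piL)) := by
  unfold Phi
  ring

theorem Phi_le_of_feasPlus {L H vL vH μ0 V : ℝ} (hvL : 0 < vL) (hμ : μ0 ∈ Set.Ioo (0:ℝ) 1)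
    {m : Mech} (hm : FeasPlus L H vL vH μ0 V m) : Phi vL vH μ0 m ≤ V + (1 - μ0) * vL := by
  obtain ⟨-, hpiL, -, -, -, -, hIRH, hIRL, -⟩ := hm
  have h0 := hμ.1
  have h1 : 0 < 1 - μ0 := sub_pos.2 hμ.2
  have hA := mul_nonneg h0.le (add_nonneg hIRH (sq_nonneg (m.xH - H)))
  have hB := mul_nonneg h1.le (add_nonneg hIRL (sq_nonneg (m.xL - L)))
  have hC := mul_nonneg h1.le (mul_nonneg hvL.le (sub_nonneg.2 hpiL))
  linarith [Phi_gap L H vL vH μ0 V m]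

/-- Attaining the upper bound forces every term of the gap to vanish. -/
theorem eq_of_feasPlus_of_le_Phi {L H vL vH μ0 V : ℝ} (hvL : 0 < vL)
    (hμ : μ0 ∈ Set.Ioo (0:ℝ) 1) {m : Mech} (hm : FeasPlus L H vL vH μ0 V m)
    (hle : V + (1 - μ0) * vL ≤ Phi vL vH μ0 m) :
    m.xH = H ∧ m.xL = L ∧ m.fL = V ∧ m.fH = V + m.piH * (vH - vL) ∧ m.piL = 1 := by
  obtain ⟨-, hpiL, -, -, -, -, hIRH, hIRL, -⟩ := hm
  have h0 := hμ.1
  have h1 : 0 < 1 - μ0 := sub_pos.2 hμ.2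
  have hgap := Phi_gap L H vL vH μ0 V m
  have hA := mul_nonneg h0.le (add_nonneg hIRH (sq_nonneg (m.xH - H)))
  have hB := mul_nonneg h1.le (add_nonneg hIRL (sq_nonneg (m.xL - L)))
  have hC := mul_nonneg h1.le (mul_nonneg hvL.le (sub_nonneg.2 hpiL))
  have hA' := (mul_eq_zero.1 (le_antisymm (by linarith) hA)).resolve_left h0.ne'
  have hB' := (mul_eq_zero.1 (le_antisymm (by linarith) hB)).resolve_left h1.ne'
  have hC' := (mul_eq_zero.1 ((mul_eq_zero.1 (le_antisymm (by linarith) hC)).resolve_left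
    h1.ne')).resolve_left hvL.ne'
  have hxH : (m.xH - H)^2 = 0 := le_antisymm (by linarith) (sq_nonneg _)
  have hxL : (m.xL - L)^2 = 0 := le_antisymm (by linarith) (sq_nonneg _)
  exact ⟨sub_eq_zero.1 (pow_eq_zero_iff two_ne_zero |>.1 hxH),
    sub_eq_zero.1 (pow_eq_zero_iff two_ne_zero |>.1 hxL), by linarith, by linarith, by linarith⟩

/-- With full disclosure after the low type, the obedience constraint bounds `piH`. -/
theorem piH_le_of_obedience {vL vH μ0 p : ℝ} (hvL : 0 < vL) (hv : vL < vH) (hμ0 : 0 < μ0)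
    (hOB : (1 - vL / vH) * μ0 * p ≤ (vL / vH) * (1 - μ0) * 1) :
    p ≤ (1 - μ0) * vL / (μ0 * (vH - vL)) := by
  have hvH : 0 < vH := hvL.trans hv
  rw [le_div_iff₀ (mul_pos hμ0 (sub_pos.2 hv))]
  have h := mul_le_mul_of_nonneg_right hOB hvH.le
  have e₁ : (1 - vL / vH) * μ0 * p * vH = p * (μ0 * (vH - vL)) := by field_simp
  have e₂ : (vL / vH) * (1 - μ0) * 1 * vH = (1 - μ0) * vL := by field_simp
  rwa [e₁, e₂] at h

/-- The efficient mechanism that never sends the low-price signal to the high type is feasible. -/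
theorem feasPlus_efficient {L H vL vH μ0 V : ℝ} (hvL : 0 < vL) (hv : vL < vH)
    (hμ : μ0 ∈ Set.Ioo (0:ℝ) 1) (hδ : (H - L)^2 ≥ vH - vL) :
    FeasPlus L H vL vH μ0 V ⟨H, L, V, V, 1, 0⟩ := by
  have hOB : 0 ≤ (vL / vH) * (1 - μ0) :=
    mul_nonneg (div_pos hvL (hvL.trans hv)).le (sub_pos.2 hμ.2).le
  refine ⟨?_, ?_, ?_, ?_, ?_, ?_, ?_, ?_, ?_⟩ <;> dsimp only <;> nlinarith

theorem stmt6 (L H vL vH μ0 V : ℝ) (hLH : L < H) (hvL : 0 < vL) (hv : vL < vH)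
    (hμ : μ0 ∈ Set.Ioo (0:ℝ) 1) (hprior : μ0 > vL / vH)
    (hδ : (H - L)^2 ≥ vH - vL) :
    IsGreatest (Phi vL vH μ0 '' {m | FeasPlus L H vL vH μ0 V m}) (V + (1 - μ0) * vL) ∧
    ∀ m : Mech, FeasPlus L H vL vH μ0 V m →
      (IsMaximizer {m' | FeasPlus L H vL vH μ0 V m'} (Phi vL vH μ0) m ↔
        (m.xH = H ∧ m.xL = L ∧ m.fL = V ∧ m.fH = V + m.piH * (vH - vL) ∧
          m.piL = 1 ∧ 0 ≤ m.piH ∧ m.piH ≤ (1 - μ0) * vL / (μ0 * (vH - vL)))) := by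
  have hfeas := feasPlus_efficient (V := V) hvL hv hμ hδ
  have hval : Phi vL vH μ0 ⟨H, L, V, V, 1, 0⟩ = V + (1 - μ0) * vL := by
    unfold Phi
    ring
  refine ⟨⟨⟨_, hfeas, hval⟩, ?_⟩, fun m hm => ⟨fun hmax => ?_, ?_⟩⟩
  · rintro _ ⟨m, hm, rfl⟩
    exact Phi_le_of_feasPlus hvL hμ hm
  · obtain ⟨hxH, hxL, hfL, hfH, hpiL⟩ :=
      eq_of_feasPlus_of_le_Phi hvL hμ hm (hval.symm.trans_le (hmax.2 _ hfeas))
    obtain ⟨-, -, hpiH, -, -, -, -, -, hOB⟩ := hm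
    rw [hpiL] at hOB
    exact ⟨hxH, hxL, hfL, hfH, hpiL, hpiH, piH_le_of_obedience hvL hv hμ.1 hOB⟩
  · rintro ⟨-, -, hfL, hfH, hpiL, -, -⟩
    refine ⟨hm, fun m' hm' => (Phi_le_of_feasPlus hvL hμ hm').trans_eq ?_⟩
    unfold Phi
    rw [hfL, hfH, hpiL]
    ring
end
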